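/- arXiv:math/0309192 — 3 statements merged into one kernel-verified Lean document; each statement's English description precedes it below -/
import Mathlib

section
/- Let X be a labeled graph. If the BKN-equation over X has a compatible solution, then the symmetric operator A⁺ = A_X⁺ has a nonpositive real eigenvalue (equivalently, A⁺ is not positive definite). -/
open Finset Matrix

/-- A labeled graph `X = (Γ, |B|, K)`: a finite connected graph with oriented edge set `W`
(carrying the fixed-point-free orientation-reversal involution `rev` and initial-vertex map
`ini`), positive integer weights `b` on oriented edges with `b (rev w) = b w`, and real
charges `k` on vertices. -/
structure LabeledGraph (V W : Type) [Fintype V] [DecidableEq V] [Fintype W] [DecidableEq W] where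
  rev : W → W
  rev_invol : ∀ w, rev (rev w) = w
  rev_ne : ∀ w, rev w ≠ w
  ini : W → V
  b : W → ℕ
  b_pos : ∀ w, 0 < b w
  b_symm : ∀ w, b (rev w) = b w
  k : V → ℝ
  edges_nonempty : Nonempty W
  connected : ∀ u v : V,
    Relation.ReflTransGen (fun x y => ∃ w, ini w = x ∧ ini (rev w) = y) u v

namespace LabeledGraph

variable {V W : Type} [Fintype V] [DecidableEq V] [Fintype W] [DecidableEq W]

/-- The terminal vertex `w⁺ = (-w)⁻` of an oriented edge. -/
def ter (X : LabeledGraph V W) (w : W) : V := X.ini (X.rev w)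

/-- The BKN-equation over `X`: `k_v · a_v = Σ_{w ∈ ∂v} (γ_w/|b_w|) · a_{w⁺}` for all `v`. -/
def BKN (X : LabeledGraph V W) (a : V → ℝ) (γ : W → ℝ) : Prop :=
  ∀ v : V, X.k v * a v =
    ∑ w ∈ univ.filter (fun w => X.ini w = v), γ w / (X.b w : ℝ) * a (X.ter w)

/-- Compatibility of a solution `(a,γ)`. -/
def Compatible (X : LabeledGraph V W) (a : V → ℝ) (γ : W → ℝ) : Prop :=
  (∀ v, 0 ≤ a v) ∧ a ≠ 0 ∧ (∀ w, |γ w| ≤ 1) ∧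
    (∀ w, |γ w * γ (X.rev w)| = 1 → γ (X.rev w) = γ w) ∧
    (∀ v, a v = 0 → ∀ w, X.ini w = v → γ w = 0 ∧ γ (X.rev w) = 0)

/-- The angle function is symmetric: `γ_{-w} = γ_w`. -/
def SymSol (X : LabeledGraph V W) (γ : W → ℝ) : Prop := ∀ w, γ (X.rev w) = γ w

/-- An NPC-solution: a compatible symmetric solution with positive length function and
`|γ| < 1`. -/
def NPCSolution (X : LabeledGraph V W) (a : V → ℝ) (γ : W → ℝ) : Prop :=
  X.BKN a γ ∧ X.Compatible a γ ∧ X.SymSol γ ∧ (∀ v, 0 < a v) ∧ ∀ w, |γ w| < 1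

/-- The operator `A⁺ = D⁺ − J` on `ℝ^V`. -/
noncomputable def Aplus (X : LabeledGraph V W) : Matrix V V ℝ :=
  Matrix.of fun v v' =>
    (if v = v' then |X.k v| else 0)
      - ∑ w ∈ univ.filter (fun w => X.ini w = v ∧ X.ter w = v'), (1 : ℝ) / (X.b w)

/-- The operator `A_λ = D − J_λ` on `ℝ^V` for a (symmetric `±1`-valued) function `λ` on `W`. -/
noncomputable def Aop (X : LabeledGraph V W) (lam : W → ℝ) : Matrix V V ℝ :=
  Matrix.of fun v v' =>
    (if v = v' then X.k v else 0)
      - ∑ w ∈ univ.filter (fun w => X.ini w = v ∧ X.ter w = v'), lam w / (X.b w : ℝ)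

/-- Two vertices lie in the same sign component. -/
def SameSign (X : LabeledGraph V W) : V → V → Prop :=
  Relation.ReflTransGen fun x y =>
    (∃ w, X.ini w = x ∧ X.ter w = y) ∧ 0 < X.k x * X.k y

/-- A `±1`-valued sign function `s` of type (ii): constant on sign components, alternating
along edges joining distinct sign components, and equal to `1` at some vertex of positive
charge. -/
def TypeII (X : LabeledGraph V W) (s : V → ℝ) : Prop :=
  (∀ v, s v = 1 ∨ s v = -1) ∧
    (∀ u v, X.SameSign u v → s u = s v) ∧
    (∀ w, ¬ X.SameSign (X.ini w) (X.ter w) → s (X.ini w) = - s (X.ter w)) ∧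
    (∃ v, s v = 1 ∧ 0 < X.k v)

/-- An admissible sign function: of type (ii), or identically zero when no type (ii)
function exists. -/
def Admissible (X : LabeledGraph V W) (s : V → ℝ) : Prop :=
  X.TypeII s ∨ (s = 0 ∧ ¬ ∃ s', X.TypeII s')

open scoped Classical in
/-- The operator `H = D_s − J₀` associated with an admissible sign function `s`; only
oriented edges with both endpoints in one and the same sign component contribute. -/
noncomputable def Hop (X : LabeledGraph V W) (s : V → ℝ) : Matrix V V ℝ :=
  Matrix.of fun v v' =>
    (if v = v' then s v * X.k v else 0)
      - ∑ w ∈ univ.filter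
          (fun w => X.ini w = v ∧ X.ter w = v' ∧ X.SameSign (X.ini w) (X.ter w)),
          (1 : ℝ) / (X.b w)

/-- `A` has a nonpositive real eigenvalue. -/
def HasNonposEigenvalue (A : Matrix V V ℝ) : Prop :=
  ∃ μ : ℝ, μ ≤ 0 ∧ ∃ x : V → ℝ, x ≠ 0 ∧ A.mulVec x = μ • x

/-- `A` has a negative real eigenvalue. -/
def HasNegEigenvalue (A : Matrix V V ℝ) : Prop :=
  ∃ μ : ℝ, μ < 0 ∧ ∃ x : V → ℝ, x ≠ 0 ∧ A.mulVec x = μ • x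

/-- `A` is positive semidefinite: `(Ax,x) ≥ 0` for all `x`. -/
def PosSemidef' (A : Matrix V V ℝ) : Prop := ∀ x : V → ℝ, 0 ≤ x ⬝ᵥ A.mulVec x

/-- `A` is singular: it has a nontrivial kernel. -/
def Singular (A : Matrix V V ℝ) : Prop := ∃ x : V → ℝ, x ≠ 0 ∧ A.mulVec x = 0

/-- `A` is supersingular: its kernel contains a vector with all coordinates nonzero. -/
def Supersingular (A : Matrix V V ℝ) : Prop :=
  ∃ x : V → ℝ, (∀ v, x v ≠ 0) ∧ A.mulVec x = 0

/-- `A` is weakly singular: there is a nonzero `x` with `(Ax)_v = 0` at every vertex of the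
support of `x`. -/
def WeaklySingular (A : Matrix V V ℝ) : Prop :=
  ∃ x : V → ℝ, x ≠ 0 ∧ ∀ v, x v ≠ 0 → A.mulVec x v = 0

end LabeledGraph

namespace LabeledGraph

variable {V W : Type} [Fintype V] [DecidableEq V] [Fintype W] [DecidableEq W]

theorem ter_rev (X : LabeledGraph V W) (w : W) : X.ter (X.rev w) = X.ini w :=
  congrArg X.ini (X.rev_invol w)

theorem Aplus_isHermitian (X : LabeledGraph V W) : X.Aplus.IsHermitian := by
  refine IsHermitian.ext fun u v => ?_
  simp only [Aplus, of_apply, star_trivial]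
  congr 1
  · simp only [eq_comm (a := v)]
    split_ifs with h
    · rw [h]
    · rfl
  · refine sum_nbij' X.rev X.rev ?_ ?_ (fun w _ => X.rev_invol w) (fun w _ => X.rev_invol w) ?_
    · intro w hw
      simp only [mem_filter, mem_univ, true_and] at hw ⊢
      exact ⟨hw.2, (X.ter_rev w).trans hw.1⟩
    · intro w hw
      simp only [mem_filter, mem_univ, true_and] at hw ⊢
      exact ⟨hw.2, (X.ter_rev w).trans hw.1⟩
    · intro w _
      rw [X.b_symm]

theorem Aplus_mulVec (X : LabeledGraph V W) (x : V → ℝ) (v : V) :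
    X.Aplus.mulVec x v =
      |X.k v| * x v - ∑ w ∈ univ.filter (fun w => X.ini w = v), 1 / (X.b w : ℝ) * x (X.ter w) := by
  simp only [mulVec, dotProduct, Aplus, of_apply, sub_mul, sum_sub_distrib, ite_mul, zero_mul,
    sum_ite_eq, mem_univ, if_true]
  congr 1
  rw [← sum_fiberwise (univ.filter fun w => X.ini w = v) X.ter]
  refine sum_congr rfl fun u _ => ?_
  rw [sum_mul, filter_filter]
  refine sum_congr rfl fun w hw => ?_
  rw [(mem_filter.mp hw).2.2]

theorem Aplus_mulVec_nonpos_of_solution (X : LabeledGraph V W) {a : V → ℝ} {γ : W → ℝ}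
    (hsol : X.BKN a γ) (ha : ∀ v, 0 ≤ a v) (hγ : ∀ w, |γ w| ≤ 1) (v : V) :
    X.Aplus.mulVec a v ≤ 0 := by
  rw [Aplus_mulVec, sub_nonpos]
  calc |X.k v| * a v = |X.k v * a v| := by rw [abs_mul, abs_of_nonneg (ha v)]
    _ = |∑ w ∈ univ.filter (fun w => X.ini w = v), γ w / (X.b w : ℝ) * a (X.ter w)| := by
      rw [hsol v]
    _ ≤ ∑ w ∈ univ.filter (fun w => X.ini w = v), |γ w / (X.b w : ℝ) * a (X.ter w)| :=
      abs_sum_le_sum_abs _ _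
    _ ≤ _ := by
      refine sum_le_sum fun w _ => ?_
      rw [abs_mul, abs_div, abs_of_nonneg (ha _), Nat.abs_cast]
      exact mul_le_mul_of_nonneg_right
        (div_le_div_of_nonneg_right (hγ w) (Nat.cast_nonneg _)) (ha _)

theorem hasNonposEigenvalue_of_not_posDef {A : Matrix V V ℝ} (hA : A.IsHermitian)
    (h : ¬ A.PosDef) : HasNonposEigenvalue A := by
  rw [hA.posDef_iff_eigenvalues_pos] at h
  push Not at h
  obtain ⟨i, hi⟩ := h
  refine ⟨hA.eigenvalues i, hi, hA.eigenvectorBasis i, fun h0 => ?_, hA.mulVec_eigenvectorBasis i⟩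
  exact hA.eigenvectorBasis.orthonormal.ne_zero i (PiLp.ext (congrFun h0))

end LabeledGraph

open LabeledGraph in
/-- If the BKN-equation over a labeled graph `X` has a compatible solution, then the
symmetric operator `A⁺ = A_X⁺` has a nonpositive real eigenvalue. -/
theorem aplus_has_nonpos_eigenvalue_of_compatible_solution
    {V W : Type} [Fintype V] [DecidableEq V] [Fintype W] [DecidableEq W]
    (X : LabeledGraph V W) (a : V → ℝ) (γ : W → ℝ)
    (hsol : X.BKN a γ) (hcomp : X.Compatible a γ) :
    HasNonposEigenvalue X.Aplus := by
  obtain ⟨ha, ha0, hγ, -, -⟩ := hcomp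
  refine hasNonposEigenvalue_of_not_posDef X.Aplus_isHermitian fun hpos => ?_
  refine (hpos.dotProduct_mulVec_pos ha0).not_ge ?_
  rw [star_trivial]
  exact sum_nonpos fun v _ =>
    mul_nonpos_of_nonneg_of_nonpos (ha v) (X.Aplus_mulVec_nonpos_of_solution hsol ha hγ v)
end

section
/- Let X be a labeled graph such that either all charges of X are zero or at least one charge is positive, let s be an admissible sign function for X and H the associated operator. If the BKN-equation over X has a compatible symmetric solution (a,γ), then (Ha,a) ≤ 0; in particular the symmetric operator H has a nonpositive real eigenvalue. -/
open Finset Matrix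

namespace LabeledGraph

variable {V W : Type} [Fintype V] [DecidableEq V] [Fintype W] [DecidableEq W]

theorem ini_rev (X : LabeledGraph V W) (w : W) : X.ini (X.rev w) = X.ter w := rfl

theorem SameSign.symm {X : LabeledGraph V W} {u v : V} (h : X.SameSign u v) :
    X.SameSign v u := by
  induction h with
  | refl => exact .refl
  | tail _ h ih =>
    obtain ⟨⟨w, rfl, rfl⟩, hk⟩ := h
    exact .head ⟨⟨X.rev w, rfl, X.ter_rev w⟩, by rwa [mul_comm]⟩ ih

theorem sum_comp_rev (X : LabeledGraph V W) (f : W → ℝ) : ∑ w, f (X.rev w) = ∑ w, f w :=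
  Equiv.sum_comp (Function.Involutive.toPerm X.rev X.rev_invol) f

open scoped Classical in
theorem Hop_isHermitian (X : LabeledGraph V W) (s : V → ℝ) : (X.Hop s).IsHermitian := by
  ext v v'
  simp only [conjTranspose_apply, Hop, of_apply, star_trivial, sum_filter]
  congr 1
  · by_cases h : v = v'
    · simp [h]
    · simp [h, Ne.symm h]
  · rw [← X.sum_comp_rev]
    refine sum_congr rfl fun w _ => ?_
    have h : X.SameSign (X.ter w) (X.ini w) ↔ X.SameSign (X.ini w) (X.ter w) :=
      ⟨SameSign.symm, SameSign.symm⟩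
    simp only [X.ini_rev, X.ter_rev, X.b_symm, h]
    exact if_congr (by tauto) rfl rfl

open scoped Classical in
/-- The quadratic form of `Hop`, with the off-diagonal part as a sum over oriented edges. -/
theorem dotProduct_Hop_mulVec (X : LabeledGraph V W) (s a : V → ℝ) :
    a ⬝ᵥ (X.Hop s).mulVec a = ∑ v, s v * X.k v * a v ^ 2
      - ∑ w, if X.SameSign (X.ini w) (X.ter w) then
          a (X.ini w) * a (X.ter w) / (X.b w : ℝ) else 0 := by
  have hoff : ∑ v, a v * ∑ v', (∑ w, if X.ini w = v ∧ X.ter w = v' ∧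
      X.SameSign (X.ini w) (X.ter w) then (1 : ℝ) / (X.b w) else 0) * a v'
      = ∑ w, if X.SameSign (X.ini w) (X.ter w) then
          a (X.ini w) * a (X.ter w) / (X.b w : ℝ) else 0 := by
    simp only [sum_mul, mul_sum]
    simp_rw [sum_comm (s := (univ : Finset V)) (t := (univ : Finset W))]
    refine sum_congr rfl fun w _ => ?_
    simp only [ite_and, ite_mul, mul_ite, zero_mul, mul_zero]
    rw [sum_eq_single (X.ini w) (fun v _ hv => by simp [Ne.symm hv]) (by simp)]
    simp only [if_true, sum_ite_eq, mem_univ]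
    split_ifs
    · ring
    · rfl
  rw [← hoff]
  simp only [dotProduct, mulVec, Hop, of_apply, sum_filter, sub_mul, sum_sub_distrib, mul_sub]
  congr 1
  refine sum_congr rfl fun v _ => ?_
  simp only [ite_mul, zero_mul, sum_ite_eq, mem_univ, if_true]
  ring

/-- Pairing the BKN-equation with `s v * a v` turns the charge term into a sum over edges. -/
theorem BKN.sum_charge_eq {X : LabeledGraph V W} {a : V → ℝ} {γ : W → ℝ} (h : X.BKN a γ)
    (s : V → ℝ) :
    ∑ v, s v * X.k v * a v ^ 2
      = ∑ w, s (X.ini w) * γ w * (a (X.ini w) * a (X.ter w) / (X.b w : ℝ)) := by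
  rw [← sum_fiberwise univ X.ini]
  refine sum_congr rfl fun v _ => ?_
  rw [show s v * X.k v * a v ^ 2 = s v * a v * (X.k v * a v) by ring, h v, mul_sum]
  refine sum_congr rfl fun w hw => ?_
  rw [(mem_filter.mp hw).2]
  ring

/-- If `s` changes sign along `w` whenever `p w` fails, such edges cancel in pairs. -/
theorem SymSol.sum_eq_zero_of_alternating {X : LabeledGraph V W} {γ : W → ℝ}
    (hγ : X.SymSol γ) (s a : V → ℝ) (p : W → Prop) [DecidablePred p]
    (hp : ∀ w, p (X.rev w) ↔ p w) (halt : ∀ w, ¬ p w → s (X.ini w) = - s (X.ter w)) :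
    ∑ w, (if p w then 0 else
      s (X.ini w) * γ w * (a (X.ini w) * a (X.ter w) / (X.b w : ℝ))) = 0 := by
  have h := X.sum_comp_rev fun w => if p w then 0 else
      s (X.ini w) * γ w * (a (X.ini w) * a (X.ter w) / (X.b w : ℝ))
  simp only [hp, X.ini_rev, X.ter_rev, X.b_symm, hγ _] at h
  refine self_eq_neg.mp (h.symm.trans ?_)
  rw [← sum_neg_distrib]
  refine sum_congr rfl fun w _ => ?_
  split_ifs with hw
  · simp
  · rw [halt w hw]
    ring

theorem Hop_form_nonpos_of_typeII {X : LabeledGraph V W} {s a : V → ℝ} {γ : W → ℝ}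
    (hs : X.TypeII s) (hsol : X.BKN a γ) (hcomp : X.Compatible a γ) (hsymm : X.SymSol γ) :
    a ⬝ᵥ (X.Hop s).mulVec a ≤ 0 := by
  classical
  obtain ⟨hval, -, halt, -⟩ := hs
  obtain ⟨ha, -, hγ, -, -⟩ := hcomp
  have hcancel := hsymm.sum_eq_zero_of_alternating s a
    (fun w => X.SameSign (X.ini w) (X.ter w))
    (fun w => by
      rw [X.ini_rev, X.ter_rev]
      exact ⟨SameSign.symm, SameSign.symm⟩) halt
  rw [dotProduct_Hop_mulVec, hsol.sum_charge_eq, sub_nonpos]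
  refine le_of_le_of_eq ?_ ((congrArg _ hcancel).trans (add_zero _))
  rw [← sum_add_distrib]
  refine sum_le_sum fun w _ => ?_
  have hnn : 0 ≤ a (X.ini w) * a (X.ter w) / (X.b w : ℝ) :=
    div_nonneg (mul_nonneg (ha _) (ha _)) (Nat.cast_nonneg _)
  have hle : s (X.ini w) * γ w ≤ 1 := by
    have := abs_le.mp (hγ w)
    rcases hval (X.ini w) with h | h <;> rw [h] <;> linarith
  split_ifs
  · simpa using mul_le_mul_of_nonneg_right hle hnn
  · simp

theorem Hop_zero_form_nonpos (X : LabeledGraph V W) {a : V → ℝ} (ha : ∀ v, 0 ≤ a v) :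
    a ⬝ᵥ (X.Hop 0).mulVec a ≤ 0 := by
  classical
  rw [dotProduct_Hop_mulVec]
  simp only [Pi.zero_apply, zero_mul, sum_const_zero, zero_sub, neg_nonpos]
  refine sum_nonneg fun w _ => ?_
  split_ifs
  · exact div_nonneg (mul_nonneg (ha _) (ha _)) (Nat.cast_nonneg _)
  · exact le_rfl

theorem hasNonposEigenvalue_of_form_nonpos {A : Matrix V V ℝ} (hA : A.IsHermitian)
    {x : V → ℝ} (hx : x ≠ 0) (h : x ⬝ᵥ A.mulVec x ≤ 0) : HasNonposEigenvalue A := by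
  obtain ⟨i, hi⟩ : ∃ i, hA.eigenvalues i ≤ 0 := by
    by_contra! hpos
    have := (hA.posDef_iff_eigenvalues_pos.mpr hpos).dotProduct_mulVec_pos hx
    rw [star_trivial] at this
    exact absurd h this.not_ge
  refine ⟨hA.eigenvalues i, hi, hA.eigenvectorBasis i, ?_, hA.mulVec_eigenvectorBasis i⟩
  intro h0
  exact hA.eigenvectorBasis.orthonormal.ne_zero i (by ext j; exact congrFun h0 j)

end LabeledGraph

open LabeledGraph in
/-- If the BKN-equation over `X` (with all charges zero or at least one positive charge)
has a compatible symmetric solution `(a,γ)`, then `(Ha,a) ≤ 0` for the operator `H`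
associated with an admissible sign function `s`; in particular `H` has a nonpositive real
eigenvalue. -/
theorem hop_form_nonpos_of_compatible_symmetric_solution
    {V W : Type} [Fintype V] [DecidableEq V] [Fintype W] [DecidableEq W]
    (X : LabeledGraph V W)
    (hcharges : (∀ v, X.k v = 0) ∨ (∃ v, 0 < X.k v))
    (s : V → ℝ) (hs : X.Admissible s)
    (a : V → ℝ) (γ : W → ℝ)
    (hsol : X.BKN a γ) (hcomp : X.Compatible a γ) (hsymm : X.SymSol γ) :
    a ⬝ᵥ (X.Hop s).mulVec a ≤ 0 ∧ HasNonposEigenvalue (X.Hop s) := by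
  have hform : a ⬝ᵥ (X.Hop s).mulVec a ≤ 0 := by
    rcases hs with hs | ⟨rfl, -⟩
    · exact Hop_form_nonpos_of_typeII hs hsol hcomp hsymm
    · exact X.Hop_zero_form_nonpos hcomp.1
  exact ⟨hform, hasNonposEigenvalue_of_form_nonpos (X.Hop_isHermitian s) hcomp.2.1 hform⟩
end

section
/- Let X be a labeled graph. The BKN-equation over X has a compatible symmetric solution (a,γ) such that γ_w = γ_{-w} ∈ {±1} for every edge w ∈ W with a_{w⁻}·a_{w⁺} ≠ 0, if and only if there exists a symmetric function λ : W → {±1} (λ_{-w} = λ_w) for which the operator A_λ is weakly singular. -/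
open Finset Matrix

namespace LabeledGraph

variable {V W : Type} [Fintype V] [DecidableEq V] [Fintype W] [DecidableEq W]

theorem Aop_mulVec (X : LabeledGraph V W) (lam : W → ℝ) (x : V → ℝ) (v : V) :
    (X.Aop lam).mulVec x v = X.k v * x v -
      ∑ w ∈ univ.filter (fun w => X.ini w = v), lam w / (X.b w : ℝ) * x (X.ter w) := by
  have h : ∑ v', (∑ w ∈ univ.filter (fun w => X.ini w = v ∧ X.ter w = v'),
      lam w / (X.b w : ℝ)) * x v' =
      ∑ w ∈ univ.filter (fun w => X.ini w = v), lam w / (X.b w : ℝ) * x (X.ter w) := by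
    rw [← Finset.sum_fiberwise (univ.filter fun w => X.ini w = v) X.ter]
    refine Finset.sum_congr rfl fun v' _ => ?_
    rw [Finset.filter_filter, Finset.sum_mul]
    refine Finset.sum_congr rfl fun w hw => ?_
    rw [(Finset.mem_filter.mp hw).2.2]
  simp only [Aop, mulVec, dotProduct, Matrix.of_apply, sub_mul, Finset.sum_sub_distrib, h]
  simp

/-- A compatible symmetric solution with angles `±1` on its support, with the angles off the
support replaced by `1`, exhibits its length function as a witness of weak singularity. -/
theorem exists_weaklySingular_Aop (X : LabeledGraph V W) {a : V → ℝ} {γ : W → ℝ}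
    (hB : X.BKN a γ) (ha : a ≠ 0) (hS : X.SymSol γ)
    (hγ : ∀ w, a (X.ini w) * a (X.ter w) ≠ 0 → γ w = 1 ∨ γ w = -1) :
    ∃ lam : W → ℝ, (∀ w, lam w = 1 ∨ lam w = -1) ∧ (∀ w, lam (X.rev w) = lam w) ∧
      WeaklySingular (X.Aop lam) := by
  refine ⟨fun w => if a (X.ini w) * a (X.ter w) ≠ 0 then γ w else 1, fun w => ?_, fun w => ?_,
    a, ha, fun v hv => ?_⟩
  · by_cases h : a (X.ini w) * a (X.ter w) ≠ 0
    · simpa only [if_pos h] using hγ w h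
    · simp only [if_neg h, true_or]
  · have h : a (X.ini (X.rev w)) * a (X.ter (X.rev w)) = a (X.ini w) * a (X.ter w) := by
      rw [ter_rev, mul_comm, ter]
    simp only [h, hS w]
  · rw [Aop_mulVec, hB v, sub_eq_zero]
    refine Finset.sum_congr rfl fun w hw => ?_
    have hw' : X.ini w = v := (Finset.mem_filter.mp hw).2
    by_cases ht : a (X.ter w) = 0
    · simp [ht]
    · have h : a (X.ini w) * a (X.ter w) ≠ 0 := mul_ne_zero (hw' ▸ hv) ht
      simp only [if_pos h]

/-- If `x` witnesses weak singularity of `A_λ`, then `|x|` is the length function of a compatible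
symmetric solution whose angles are `λ` twisted by the signs of `x` at the two endpoints. -/
theorem exists_solution_of_weaklySingular (X : LabeledGraph V W) {lam : W → ℝ}
    (hl : ∀ w, lam w = 1 ∨ lam w = -1) (hs : ∀ w, lam (X.rev w) = lam w)
    (hA : WeaklySingular (X.Aop lam)) :
    ∃ (a : V → ℝ) (γ : W → ℝ), X.BKN a γ ∧ X.Compatible a γ ∧ X.SymSol γ ∧
      ∀ w, a (X.ini w) * a (X.ter w) ≠ 0 → γ w = 1 ∨ γ w = -1 := by
  obtain ⟨x, hx, hxA⟩ := hA
  set σ : V → ℝ := fun v => (SignType.sign (x v) : ℝ) with hσ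
  have hσ0 : ∀ v, x v = 0 → σ v = 0 := fun v h => by simp [hσ, h]
  have hσ1 : ∀ v, x v ≠ 0 → σ v = 1 ∨ σ v = -1 := fun v h =>
    h.lt_or_gt.symm.imp (fun h => by simp [hσ, h]) fun h => by simp [hσ, h]
  have habs : ∀ v, |x v| = σ v * x v := fun v => (sign_mul_self _).symm
  have hσx : ∀ v, σ v * |x v| = x v := fun v => sign_mul_abs _
  set γ : W → ℝ := fun w => lam w * (σ (X.ini w) * σ (X.ter w)) with hγ
  have hγrev : ∀ w, γ (X.rev w) = γ w := fun w => by
    simp only [hγ, hs, ter_rev, mul_comm (σ (X.ini (X.rev w)))]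
    rfl
  have hpm : ∀ w, |x (X.ini w)| * |x (X.ter w)| ≠ 0 → γ w = 1 ∨ γ w = -1 := fun w h => by
    rcases hl w with h1 | h1 <;>
      rcases hσ1 _ (abs_ne_zero.mp (left_ne_zero_of_mul h)) with h2 | h2 <;>
      rcases hσ1 _ (abs_ne_zero.mp (right_ne_zero_of_mul h)) with h3 | h3 <;>
      simp [hγ, h1, h2, h3]
  have hγ0 : ∀ w, |x (X.ini w)| * |x (X.ter w)| = 0 → γ w = 0 := fun w h => by
    rcases mul_eq_zero.mp h with h | h <;> simp [hγ, hσ0 _ (abs_eq_zero.mp h)]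
  refine ⟨fun v => |x v|, γ, fun v => ?_, ⟨fun v => abs_nonneg _, fun h => hx ?_, fun w => ?_,
    fun w _ => hγrev w, fun v hv w hw => ?_⟩, hγrev, hpm⟩
  · have hsum : ∑ w ∈ univ.filter (fun w => X.ini w = v), γ w / (X.b w : ℝ) * |x (X.ter w)| =
        σ v * ∑ w ∈ univ.filter (fun w => X.ini w = v), lam w / (X.b w : ℝ) * x (X.ter w) := by
      rw [Finset.mul_sum]
      refine Finset.sum_congr rfl fun w hw => ?_
      rw [← (Finset.mem_filter.mp hw).2]
      calc γ w / (X.b w : ℝ) * |x (X.ter w)|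
          = σ (X.ini w) * (lam w / (X.b w : ℝ) * (σ (X.ter w) * |x (X.ter w)|)) := by
            simp only [hγ]; ring
        _ = _ := by rw [hσx]
    rw [hsum]
    change X.k v * |x v| = _
    rw [habs]
    by_cases hv : x v = 0
    · simp [hσ0 v hv]
    · have h := hxA v hv
      rw [Aop_mulVec, sub_eq_zero] at h
      rw [← h]
      ring
  · exact funext fun v => abs_eq_zero.mp (congrFun h v)
  · by_cases h : |x (X.ini w)| * |x (X.ter w)| = 0
    · simp [hγ0 w h]
    · rcases hpm w h with h | h <;> simp [h]
  · have h : γ w = 0 := hγ0 w (mul_eq_zero_of_left (hw ▸ hv) _)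
    exact ⟨h, (hγrev w).trans h⟩

end LabeledGraph

open LabeledGraph in
/-- Spectral criterion for (E): the BKN-equation over `X` has a compatible symmetric
solution `(a,γ)` with `γ_w = γ_{-w} = ±1` for every edge `w` with `a_{w⁻}·a_{w⁺} ≠ 0` iff
the operator `A_λ` is weakly singular for some symmetric `±1`-valued function `λ` on `W`. -/
theorem compatible_symmetric_pm_one_solution_iff_weakly_singular
    {V W : Type} [Fintype V] [DecidableEq V] [Fintype W] [DecidableEq W]
    (X : LabeledGraph V W) :
    (∃ (a : V → ℝ) (γ : W → ℝ), X.BKN a γ ∧ X.Compatible a γ ∧ X.SymSol γ ∧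
      ∀ w, a (X.ini w) * a (X.ter w) ≠ 0 → γ w = 1 ∨ γ w = -1) ↔
    (∃ lam : W → ℝ, (∀ w, lam w = 1 ∨ lam w = -1) ∧ (∀ w, lam (X.rev w) = lam w) ∧
      WeaklySingular (X.Aop lam)) := by
  exact ⟨fun ⟨_, _, hB, hC, hS, hγ⟩ => X.exists_weaklySingular_Aop hB hC.2.1 hS hγ,
    fun ⟨_, hl, hs, hA⟩ => X.exists_solution_of_weaklySingular hl hs hA⟩
end
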